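/- Let 1 ≤ p ≤ n be integers, let Λ₁,…,Λ_p be pairwise distinct positive reals, and let x ∈ ℝ. Then Σ_{j=1}^{p} [ e^{−x/Λ_j} Λ_j^{−n} / ∏_{l≠j} (1 − Λ_l/Λ_j) ] · Σ_{k=1}^{p} x^{n−k} E_{k−1}(−Λ^ĵ)/(n−k)! = det M / det D_Λ, where D_Λ is the p×p matrix with entries (D_Λ)_{k,j} = Λ_j^{−k+1} (1 ≤ k,j ≤ p), and M is the (p+1)×(p+1) block matrix [[0, B_Λ(x)], [C(x), D_Λ]] whose first row after the (1,1) entry 0 is the row vector B_Λ(x) with entries B_Λ(x)_j = e^{−x/Λ_j} Λ_j^{−n}, and whose first column below the (1,1) entry is the column vector C(x) with entries C(x)_k = −x^{n−k}/(n−k)!. (Here det D_Λ = ∏_{j > j'} (Λ_j^{−1} − Λ_{j'}^{−1}) ≠ 0.) -/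

import Mathlib

open Matrix

/-- The `k`-th elementary symmetric function of `(v i)_{i ∈ s}`. -/
noncomputable def esymm {p : ℕ} (s : Finset (Fin p)) (v : Fin p → ℝ) (k : ℕ) : ℝ :=
  ∑ t ∈ s.powersetCard k, ∏ i ∈ t, v i

/-- Determinant of a bordered matrix with zero corner, when the lower right block has a left
inverse. -/
theorem Matrix.det_bordered_of_mul_eq_one {R : Type*} [CommRing R] {p : ℕ}
    (M : Matrix (Fin (p + 1)) (Fin (p + 1)) R) (G D : Matrix (Fin p) (Fin p) R)
    (hGD : G * D = 1) (h0 : M 0 0 = 0) (hD : ∀ i j : Fin p, M i.succ j.succ = D i j) :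
    M.det = D.det * -∑ j, M 0 j.succ * ∑ k, G j k * M k.succ 0 := by
  let e : Fin (p + 1) ≃ Fin p ⊕ Unit := (finSuccEquiv p).trans (Equiv.optionEquivSumPUnit _)
  let _ : Invertible D := ⟨G, hGD, mul_eq_one_comm.mp hGD⟩
  have hinv : ⅟D = G := invOf_eq_left_inv hGD
  have hM : M.submatrix e.symm e.symm =
      fromBlocks D (of fun k _ => M k.succ 0) (of fun _ j => M 0 j.succ) 0 := by
    ext (i | i) (j | j) <;> simp [e, h0, hD]
  rw [← det_submatrix_equiv_self e.symm M, hM, det_fromBlocks₁₁, hinv]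
  congr 1
  simp only [Matrix.mul_assoc, det_unique, zero_sub, neg_apply, mul_apply, of_apply]

/-- Generating function of the elementary symmetric functions. -/
theorem prod_one_add_mul_eq_sum_esymm {p : ℕ} (s : Finset (Fin p)) (v : Fin p → ℝ) (t : ℝ) :
    ∏ i ∈ s, (1 + v i * t) = ∑ k ∈ Finset.range (s.card + 1), esymm s v k * t ^ k := by
  rw [Finset.prod_one_add, Finset.sum_powerset]
  refine Finset.sum_congr rfl fun k _ => ?_
  rw [esymm, Finset.sum_mul]
  refine Finset.sum_congr rfl fun u hu => ?_
  rw [Finset.prod_mul_distrib, Finset.prod_const, (Finset.mem_powersetCard.mp hu).2]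

/-- The inverse of the matrix `(Λ_j ^ (-k))_{k,j}` in terms of elementary symmetric functions. -/
theorem esymm_div_prod_mul_zpow_eq_one {p : ℕ} (Λ : Fin p → ℝ) (hΛ : ∀ j, Λ j ≠ 0)
    (hdist : Function.Injective Λ) :
    (of fun j k : Fin p => esymm (Finset.univ.erase j) (fun l => -Λ l) k /
        ∏ l ∈ Finset.univ.erase j, (1 - Λ l / Λ j)) *
      (of fun k j : Fin p => (Λ j) ^ (-(k.val : ℤ))) = 1 := by
  ext i j
  have hcard : (Finset.univ.erase i).card + 1 = p := by
    rw [Finset.card_erase_add_one (Finset.mem_univ i), Finset.card_univ, Fintype.card_fin]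
  have key : ∑ k : Fin p, esymm (Finset.univ.erase i) (fun l => -Λ l) k * (Λ j) ^ (-(k.val : ℤ))
      = ∏ l ∈ Finset.univ.erase i, (1 - Λ l / Λ j) := by
    have h := prod_one_add_mul_eq_sum_esymm (Finset.univ.erase i) (fun l => -Λ l) (Λ j)⁻¹
    rw [hcard, Finset.sum_range] at h
    simpa [div_eq_mul_inv, sub_eq_add_neg] using h.symm
  simp only [mul_apply, of_apply, div_mul_eq_mul_div]
  rw [← Finset.sum_div, key]
  rcases eq_or_ne i j with rfl | hij
  · rw [one_apply_eq, div_self]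
    refine Finset.prod_ne_zero_iff.mpr fun l hl => ?_
    rw [sub_ne_zero, ne_comm, Ne, div_eq_one_iff_eq (hΛ i)]
    exact hdist.ne (Finset.ne_of_mem_erase hl)
  · rw [one_apply_ne hij, Finset.prod_eq_zero (i := j), zero_div]
    · simp [hij.symm]
    · rw [div_self (hΛ j), sub_self]

/-- For `1 ≤ p ≤ n`, pairwise distinct positive `Λ₁,…,Λ_p`, and `x ∈ ℝ`:
`Σ_j [e^{−x/Λ_j} Λ_j^{−n} / ∏_{l≠j}(1−Λ_l/Λ_j)] Σ_{k=1}^p x^{n−k} E_{k−1}(−Λ^ĵ)/(n−k)!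
  = det M / det D_Λ`, where `(D_Λ)_{k,j} = Λ_j^{−k+1}` (`1 ≤ k,j ≤ p`) and `M` is the
`(p+1) × (p+1)` block matrix `[[0, B_Λ(x)], [C(x), D_Λ]]` with `B_Λ(x)_j = e^{−x/Λ_j} Λ_j^{−n}`
and `C(x)_k = −x^{n−k}/(n−k)!`. -/
theorem one_point_function_determinant_identity
    (p n : ℕ) (hp : 1 ≤ p) (hpn : p ≤ n)
    (Λ : Fin p → ℝ) (hΛ : ∀ j, 0 < Λ j) (hdist : Function.Injective Λ)
    (x : ℝ) :
    (∑ j, (Real.exp (-(x / Λ j)) * ((Λ j) ^ n)⁻¹ /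
          ∏ l ∈ Finset.univ.erase j, (1 - Λ l / Λ j)) *
        ∑ k ∈ Finset.Icc 1 p, x ^ (n - k) *
          esymm (Finset.univ.erase j) (fun l => -Λ l) (k - 1) / (Nat.factorial (n - k)))
      = (Matrix.of fun i j : Fin (p + 1) =>
            Fin.cases
              (Fin.cases (0 : ℝ)
                (fun j' => Real.exp (-(x / Λ j')) * ((Λ j') ^ n)⁻¹) j)
              (fun i' =>
                Fin.cases
                  (-(x ^ (n - (i'.val + 1)) / (Nat.factorial (n - (i'.val + 1)))))
                  (fun j' => (Λ j') ^ (-(i'.val : ℤ))) j) i).det /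
          (Matrix.of fun k j : Fin p => (Λ j) ^ (-(k.val : ℤ))).det := by
  have hGD := esymm_div_prod_mul_zpow_eq_one Λ (fun j => (hΛ j).ne') hdist
  have hdet : (of fun k j : Fin p => (Λ j) ^ (-(k.val : ℤ))).det ≠ 0 :=
    (isUnit_det_of_left_inverse hGD).ne_zero
  rw [eq_div_iff hdet, det_bordered_of_mul_eq_one _ _ _ hGD rfl fun _ _ => rfl, mul_comm]
  congr 1
  rw [← Finset.sum_neg_distrib]
  refine Finset.sum_congr rfl fun j _ => ?_
  rw [← Finset.Ico_add_one_right_eq_Icc, Finset.sum_Ico_eq_sum_range, Nat.add_sub_cancel,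
    Finset.sum_range]
  simp only [of_apply, Fin.cases_zero, Fin.cases_succ, Nat.add_sub_cancel_left]
  rw [← mul_neg, ← Finset.sum_neg_distrib, Finset.mul_sum, Finset.mul_sum]
  refine Finset.sum_congr rfl fun k _ => ?_
  rw [add_comm 1 k.val]
  ring
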